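/- Let (W, μ) be a Möbius space with W of dimension 4, and let P ∈ W be a point (μ(P) = 1). Then every x ∈ Λ²W can be written as x = P ∧ v + u ∧ w for some vectors v, u, w ∈ ker μ. (Poinsot theorem: every system of applied forces is equivalent to the combination of one force and one Poinsot pair.) -/

import Mathlib

open ExteriorAlgebra

namespace ExteriorAlgebra

theorem ι_mul_ι_eq_neg {R M : Type*} [CommRing R] [AddCommGroup M] [Module R M] (a b : M) :
    ι R b * ι R a = -(ι R a * ι R b) :=
  eq_neg_of_add_eq_zero_left (ι_add_mul_swap b a)

/-- Over a field, every bivector in the span of `e₁ ∧ e₂`, `e₂ ∧ e₀`, `e₀ ∧ e₁` is decomposable,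
with factors in any submodule containing the `eᵢ`. -/
theorem exists_ι_mul_ι_eq_of_three {K V : Type*} [Field K] [AddCommGroup V] [Module K V]
    (S : Submodule K V) (e : Fin 3 → V) (he : ∀ i, e i ∈ S) (p q r : K) :
    ∃ u ∈ S, ∃ w ∈ S, p • (ι K (e 1) * ι K (e 2)) + q • (ι K (e 2) * ι K (e 0)) +
      r • (ι K (e 0) * ι K (e 1)) = ι K u * ι K w := by
  by_cases hr : r = 0
  · refine ⟨p • e 1 - q • e 0, S.sub_mem (S.smul_mem _ (he 1)) (S.smul_mem _ (he 0)),
      e 2, he 2, ?_⟩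
    simp only [map_sub, map_smul, sub_mul, smul_mul_assoc, hr, ι_mul_ι_eq_neg (e 0) (e 2)]
    module
  · refine ⟨e 0 - (p / r) • e 2, S.sub_mem (he 0) (S.smul_mem _ (he 2)),
      r • e 1 - q • e 2, S.sub_mem (S.smul_mem _ (he 1)) (S.smul_mem _ (he 2)), ?_⟩
    simp only [map_sub, map_smul, sub_mul, mul_sub, smul_mul_assoc, mul_smul_comm, ι_sq_zero,
      ι_mul_ι_eq_neg (e 0) (e 2), ι_mul_ι_eq_neg (e 1) (e 2)]
    match_scalars <;> field_simp

/-- If `P` and a three-element family `e` span `V`, then every bivector is the sum of some `P ∧ v`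
with `v` in the span of `e` and a combination of the products of members of `e`. -/
theorem exists_eq_ι_mul_ι_add_of_mem_exteriorPower_two {R M : Type*} [CommRing R] [AddCommGroup M]
    [Module R M] (P : M) (e : Fin 3 → M)
    (hspan : ∀ a : M, ∃ (c : R) (d : Fin 3 → R), a = c • P + ∑ i, d i • e i)
    {x : ExteriorAlgebra R M} (hx : x ∈ ⋀[R]^2 M) :
    ∃ v ∈ Submodule.span R (Set.range e), ∃ p q r : R, x = ι R P * ι R v +
      (p • (ι R (e 1) * ι R (e 2)) + q • (ι R (e 2) * ι R (e 0)) +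
        r • (ι R (e 0) * ι R (e 1))) := by
  have hx' : x ∈ LinearMap.range (ι R : M →ₗ[R] ExteriorAlgebra R M) *
      LinearMap.range (ι R : M →ₗ[R] ExteriorAlgebra R M) := by
    rwa [← pow_two]
  induction hx' using Submodule.mul_induction_on' with
  | mem_mul_mem a ha b hb =>
    obtain ⟨a, rfl⟩ := ha
    obtain ⟨b, rfl⟩ := hb
    obtain ⟨c, s, rfl⟩ := hspan a
    obtain ⟨d, t, rfl⟩ := hspan b
    have hmem (s : Fin 3 → R) : ∑ i, s i • e i ∈ Submodule.span R (Set.range e) :=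
      Submodule.sum_mem _ fun i _ =>
        Submodule.smul_mem _ _ (Submodule.subset_span (Set.mem_range_self i))
    refine ⟨c • ∑ i, t i • e i - d • ∑ i, s i • e i,
      Submodule.sub_mem _ (Submodule.smul_mem _ _ (hmem t)) (Submodule.smul_mem _ _ (hmem s)),
      s 1 * t 2 - s 2 * t 1, s 2 * t 0 - s 0 * t 2, s 0 * t 1 - s 1 * t 0, ?_⟩
    simp only [Fin.sum_univ_three, map_add, map_sub, map_smul, add_mul, mul_add, mul_sub,
      smul_mul_assoc, mul_smul_comm, ι_sq_zero, ι_mul_ι_eq_neg P (e _),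
      ι_mul_ι_eq_neg (e 0) (e 2), ι_mul_ι_eq_neg (e 1) (e 2), ι_mul_ι_eq_neg (e 0) (e 1)]
    module
  | add y hy z hz ihy ihz =>
    obtain ⟨v, hv, p, q, r, rfl⟩ := ihy (by rwa [exteriorPower, pow_two])
    obtain ⟨v', hv', p', q', r', rfl⟩ := ihz (by rwa [exteriorPower, pow_two])
    refine ⟨v + v', Submodule.add_mem _ hv hv', p + p', q + q', r + r', ?_⟩
    rw [map_add, mul_add]
    module

end ExteriorAlgebra

/-- Let `(W, μ)` be a Möbius space with `W` of dimension 4, and `P ∈ W` a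
point (`μ P = 1`).  Every `x ∈ Λ²W` can be written as `x = P ∧ v + u ∧ w` with vectors
`v, u, w ∈ ker μ` (Poinsot theorem: every system of applied forces is equivalent to a
force together with a Poinsot pair). -/
theorem statement16 {W : Type*} [AddCommGroup W] [Module ℝ W]
    (hdim : Module.finrank ℝ W = 4)
    (μ : W →ₗ[ℝ] ℝ) (hμ : μ ≠ 0) (P : W) (hP : μ P = 1)
    (x : ExteriorAlgebra ℝ W) (hx : x ∈ ⋀[ℝ]^2 W) :
    ∃ v u w : W, μ v = 0 ∧ μ u = 0 ∧ μ w = 0 ∧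
      x = ι ℝ P * ι ℝ v + ι ℝ u * ι ℝ w := by
  have : FiniteDimensional ℝ W := FiniteDimensional.of_finrank_pos (by omega)
  have hker : Module.finrank ℝ (LinearMap.ker μ) = 3 := by
    have := Module.Dual.finrank_ker_add_one_of_ne_zero hμ
    omega
  let b := Module.finBasisOfFinrankEq ℝ (LinearMap.ker μ) hker
  have hb (i : Fin 3) : (b i : W) ∈ LinearMap.ker μ := (b i).2
  obtain ⟨v, hv, p, q, r, rfl⟩ :=
    exists_eq_ι_mul_ι_add_of_mem_exteriorPower_two P (fun i => (b i : W)) (fun a => by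
      have ha : a - μ a • P ∈ LinearMap.ker μ := by simp [hP]
      refine ⟨μ a, b.repr ⟨_, ha⟩, ?_⟩
      have h := congrArg Subtype.val (b.sum_repr ⟨_, ha⟩)
      simp only [Submodule.coe_sum, Submodule.coe_smul] at h
      rw [h, add_sub_cancel]) hx
  obtain ⟨u, hu, w, hw, h⟩ :=
    exists_ι_mul_ι_eq_of_three (LinearMap.ker μ) (fun i => (b i : W)) hb p q r
  exact ⟨v, u, w, Submodule.span_le.2 (Set.range_subset_iff.2 hb) hv, hu, hw, by rw [h]⟩
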